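/- arXiv:1702.01753 — 2 statements merged into one kernel-verified Lean document; each statement's English description precedes it below -/
import Mathlib

section
/- Let Q ⊆ Sym TT_n be a cyclic quadratic module and let H_Q = {h ∈ TT_n : there exists a positive rational ρ with ρ·I − hhᵀ ∈ Q}. Then H_Q is an ℝ-subalgebra of TT_n (it contains ℝ·I and is closed under addition and multiplication) which is moreover closed under the transpose involution and satisfies: h ∈ H_Q implies tr(h)·I ∈ H_Q. -/
noncomputable section

open Matrix

/-- The polynomial ring ℝ[ξ] in the g·n² commuting variables ξ_{jıȷ}. -/
abbrev PolyRing (n g : ℕ) : Type := MvPolynomial (Fin g × Fin n × Fin n) ℝ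

/-- n×n matrices over ℝ[ξ]. -/
abbrev MatP (n g : ℕ) : Type := Matrix (Fin n) (Fin n) (PolyRing n g)

/-- The generic matrices Ξ_j = (ξ_{jıȷ})_{ıȷ}. -/
def genMat (n g : ℕ) (j : Fin g) : MatP n g :=
  Matrix.of fun a b => MvPolynomial.X (j, a, b)

/-- The set of generic matrices together with their transposes. -/
def genSet (n g : ℕ) : Set (MatP n g) :=
  Set.range (genMat n g) ∪ Set.range (fun j => (genMat n g j)ᵀ)

/-- The trace ring TT_n: the ℝ-subalgebra of M_n(ℝ[ξ]) generated by the Ξ_j, their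
transposes, and the scalar matrices tr(w)·1 for all products w of the Ξ_j, Ξ_jᵀ. -/
def traceRing (n g : ℕ) : Subalgebra ℝ (MatP n g) :=
  Algebra.adjoin ℝ
    (genSet n g ∪
      {m | ∃ w ∈ Submonoid.closure (genSet n g), m = (Matrix.trace w) • (1 : MatP n g)})

/-- The center C_n of the trace ring: the scalar matrices in TT_n. -/
def centerSet (n g : ℕ) : Set (MatP n g) :=
  {c | c ∈ traceRing n g ∧ ∃ p : PolyRing n g, c = p • (1 : MatP n g)}

/-- Evaluation of a matrix of polynomials at a g-tuple X of n×n real matrices. -/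
def evalMat (n g : ℕ) (X : Fin g → Matrix (Fin n) (Fin n) ℝ) (h : MatP n g) :
    Matrix (Fin n) (Fin n) ℝ :=
  h.map (MvPolynomial.eval fun v => X v.1 v.2.1 v.2.2)

/-- The semialgebraic set K_S determined by S. -/
def KSet (n g : ℕ) (S : Set (MatP n g)) : Set (Fin g → Matrix (Fin n) (Fin n) ℝ) :=
  {X | ∀ s ∈ S, (evalMat n g X s).PosSemidef}

/-- Cyclic quadratic module in Sym TT_n. -/
def IsCyclicQM (n g : ℕ) (Q : Set (MatP n g)) : Prop :=
  (∀ q ∈ Q, q ∈ traceRing n g ∧ qᵀ = q) ∧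
  (1 : MatP n g) ∈ Q ∧
  (∀ a ∈ Q, ∀ b ∈ Q, a + b ∈ Q) ∧
  (∀ h ∈ traceRing n g, ∀ q ∈ Q, h * q * hᵀ ∈ Q) ∧
  (∀ q ∈ Q, (Matrix.trace q) • (1 : MatP n g) ∈ Q)

/-- Cyclic preordering: a cyclic quadratic module whose intersection with the center
is closed under multiplication. -/
def IsCyclicPreordering (n g : ℕ) (T : Set (MatP n g)) : Prop :=
  IsCyclicQM n g T ∧
  ∀ a ∈ T ∩ centerSet n g, ∀ b ∈ T ∩ centerSet n g, a * b ∈ T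

/-- The smallest cyclic preordering T_S^tr containing S. -/
def TtrS (n g : ℕ) (S : Set (MatP n g)) : Set (MatP n g) :=
  {a | ∀ T : Set (MatP n g), IsCyclicPreordering n g T → S ⊆ T → a ∈ T}

/-- The set H_Q of Q-bounded elements of TT_n. -/
def HQ (n g : ℕ) (Q : Set (MatP n g)) : Set (MatP n g) :=
  {h | h ∈ traceRing n g ∧ ∃ ρ : ℚ, 0 < ρ ∧
    (ρ : ℝ) • (1 : MatP n g) - h * hᵀ ∈ Q}

/-- The trace ring is closed under the transpose involution. -/
theorem transpose_mem_traceRing {n g : ℕ} {h : MatP n g} (hh : h ∈ traceRing n g) :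
    hᵀ ∈ traceRing n g := by
  induction hh using Algebra.adjoin_induction with
  | mem x hx =>
    rcases hx with (⟨j, rfl⟩ | ⟨j, rfl⟩) | ⟨w, hw, rfl⟩
    · exact Algebra.subset_adjoin (Or.inl (Or.inr ⟨j, rfl⟩))
    · exact Algebra.subset_adjoin (Or.inl (Or.inl ⟨j, rfl⟩))
    · rw [transpose_smul, transpose_one]
      exact Algebra.subset_adjoin (Or.inr ⟨w, hw, rfl⟩)
  | algebraMap r =>
    rw [Algebra.algebraMap_eq_smul_one, transpose_smul, transpose_one]
    exact Subalgebra.smul_mem _ (one_mem _) r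
  | add x y _ _ hx hy => rw [transpose_add]; exact add_mem hx hy
  | mul x y _ _ hx hy => rw [transpose_mul]; exact mul_mem hy hx

/-- The trace ring is closed under the map `h ↦ tr(h)·1`. -/
theorem trace_smul_one_mem_traceRing {n g : ℕ} {h : MatP n g} (hh : h ∈ traceRing n g) :
    trace h • (1 : MatP n g) ∈ traceRing n g := by
  have trace_mul_mem : ∀ x ∈ Submonoid.closure (genSet n g ∪
      {m | ∃ w ∈ Submonoid.closure (genSet n g), m = (Matrix.trace w) • (1 : MatP n g)}),
      ∀ w ∈ Submonoid.closure (genSet n g),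
        trace (w * x) • (1 : MatP n g) ∈ traceRing n g := by
    intro x hx
    induction hx using Submonoid.closure_induction_left with
    | one =>
      intro w hw
      rw [mul_one]
      exact Algebra.subset_adjoin (Or.inr ⟨w, hw, rfl⟩)
    | mul_left x hx y _ ih =>
      intro w hw
      rcases hx with hx | ⟨v, hv, rfl⟩
      · rw [← mul_assoc]
        exact ih _ (mul_mem hw (Submonoid.subset_closure hx))
      · have key : trace (w * (trace v • (1 : MatP n g) * y)) • (1 : MatP n g) =
            (trace v • (1 : MatP n g)) * (trace (w * y) • (1 : MatP n g)) := by
          simp [smul_smul, mul_comm]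
        rw [key]
        exact mul_mem (Algebra.subset_adjoin (Or.inr ⟨v, hv, rfl⟩)) (ih w hw)
  rw [traceRing, ← Subalgebra.mem_toSubmodule, Algebra.adjoin_eq_span] at hh
  induction hh using Submodule.span_induction with
  | mem x hx => simpa using trace_mul_mem x hx 1 (one_mem _)
  | zero => simp
  | add x y _ _ hx hy => rw [trace_add, add_smul]; exact add_mem hx hy
  | smul r x _ hx => rw [trace_smul, smul_assoc]; exact Subalgebra.smul_mem _ hx r

namespace IsCyclicQM

variable {n g : ℕ} {Q : Set (MatP n g)}

theorem add_mem (hQ : IsCyclicQM n g Q) {a b : MatP n g} (ha : a ∈ Q) (hb : b ∈ Q) :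
    a + b ∈ Q := hQ.2.2.1 a ha b hb

theorem conj_mem (hQ : IsCyclicQM n g Q) {h q : MatP n g} (hh : h ∈ traceRing n g)
    (hq : q ∈ Q) : h * q * hᵀ ∈ Q := hQ.2.2.2.1 h hh q hq

theorem mul_transpose_mem (hQ : IsCyclicQM n g Q) {h : MatP n g} (hh : h ∈ traceRing n g) :
    h * hᵀ ∈ Q := by
  simpa using hQ.conj_mem hh hQ.2.1

theorem smul_mem (hQ : IsCyclicQM n g Q) {r : ℝ} (hr : 0 ≤ r) {q : MatP n g} (hq : q ∈ Q) :
    r • q ∈ Q := by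
  have h := hQ.conj_mem (Subalgebra.smul_mem _ (one_mem (traceRing n g)) (√r)) hq
  simpa [transpose_smul, smul_smul, Real.mul_self_sqrt hr] using h

theorem of_smul_mem (hQ : IsCyclicQM n g Q) {r : ℝ} (hr : 0 < r) {q : MatP n g}
    (hq : r • q ∈ Q) : q ∈ Q := by
  simpa [smul_smul, inv_mul_cancel₀ hr.ne'] using hQ.smul_mem (inv_nonneg.2 hr.le) hq

/-- A real bound can always be enlarged to a positive rational one. -/
theorem mem_HQ_of_real_bound (hQ : IsCyclicQM n g Q) {h : MatP n g} (hh : h ∈ traceRing n g)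
    {c : ℝ} (hc : c • (1 : MatP n g) - h * hᵀ ∈ Q) : h ∈ HQ n g Q := by
  obtain ⟨ρ, hρ⟩ := exists_rat_gt (max c 0)
  have hρc : c < ρ := (le_max_left _ _).trans_lt hρ
  have hρ0 : (0 : ℝ) < ρ := (le_max_right _ _).trans_lt hρ
  refine ⟨hh, ρ, by exact_mod_cast hρ0, ?_⟩
  have h1 := hQ.add_mem (hQ.smul_mem (sub_nonneg.2 hρc.le) hQ.2.1) hc
  convert h1 using 1
  module

theorem smul_one_mem_HQ (hQ : IsCyclicQM n g Q) (r : ℝ) : r • (1 : MatP n g) ∈ HQ n g Q := by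
  refine hQ.mem_HQ_of_real_bound (Subalgebra.smul_mem _ (one_mem _) r) (c := r * r + 1) ?_
  convert hQ.2.1 using 1
  simp only [transpose_smul, transpose_one, smul_mul_smul_comm, mul_one]
  module

theorem add_mem_HQ (hQ : IsCyclicQM n g Q) {a b : MatP n g} (ha : a ∈ HQ n g Q)
    (hb : b ∈ HQ n g Q) : a + b ∈ HQ n g Q := by
  obtain ⟨ha, ρ, -, hρ⟩ := ha
  obtain ⟨hb, σ, -, hσ⟩ := hb
  refine hQ.mem_HQ_of_real_bound (AddMemClass.add_mem ha hb) (c := 2 * ρ + 2 * σ) ?_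
  have h1 := hQ.add_mem (hQ.smul_mem zero_le_two (hQ.add_mem hρ hσ))
    (hQ.mul_transpose_mem (sub_mem ha hb))
  convert h1 using 1
  simp only [transpose_add, transpose_sub, mul_add, add_mul, mul_sub, sub_mul]
  module

theorem mul_mem_HQ (hQ : IsCyclicQM n g Q) {a b : MatP n g} (ha : a ∈ HQ n g Q)
    (hb : b ∈ HQ n g Q) : a * b ∈ HQ n g Q := by
  obtain ⟨ha, ρ, -, hρ⟩ := ha
  obtain ⟨hb, σ, hσ0, hσ⟩ := hb
  refine hQ.mem_HQ_of_real_bound (mul_mem ha hb) (c := σ * ρ) ?_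
  have h1 := hQ.add_mem (hQ.conj_mem ha hσ)
    (hQ.smul_mem (r := σ) (by exact_mod_cast hσ0.le) hρ)
  convert h1 using 1
  simp only [transpose_mul, mul_sub, sub_mul, mul_smul_comm, smul_mul_assoc, mul_one, mul_assoc]
  module

theorem transpose_mem_HQ (hQ : IsCyclicQM n g Q) {a : MatP n g} (ha : a ∈ HQ n g Q) :
    aᵀ ∈ HQ n g Q := by
  obtain ⟨ha, ρ, hρ0, hρ⟩ := ha
  have hat := transpose_mem_traceRing ha
  refine hQ.mem_HQ_of_real_bound hat (c := ρ) (hQ.of_smul_mem (r := ρ) (by exact_mod_cast hρ0) ?_)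
  have h1 := hQ.add_mem (hQ.conj_mem hat hρ) (hQ.mul_transpose_mem
    (sub_mem (Subalgebra.smul_mem _ (one_mem _) (ρ : ℝ)) (mul_mem hat ha)))
  convert h1 using 1
  simp only [transpose_mul, transpose_sub, transpose_smul, transpose_one, transpose_transpose,
    mul_sub, sub_mul, mul_smul_comm, smul_mul_assoc, mul_one, one_mul, mul_assoc]
  module

/-- If `c² - s²` lies in `Q` for a symmetric `s` and `c > 0`, then so does `c + s`. -/
theorem smul_one_add_mem (hQ : IsCyclicQM n g Q) {s : MatP n g} (hs : s ∈ traceRing n g)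
    (hst : sᵀ = s) {c : ℝ} (hc : 0 < c) (h : (c * c) • (1 : MatP n g) - s * s ∈ Q) :
    c • (1 : MatP n g) + s ∈ Q := by
  refine hQ.of_smul_mem (r := 2 * c) (by positivity) ?_
  have h1 := hQ.add_mem h (hQ.mul_transpose_mem
    (AddMemClass.add_mem (Subalgebra.smul_mem _ (one_mem _) c) hs))
  convert h1 using 1
  simp only [transpose_add, transpose_smul, transpose_one, hst,
    mul_add, add_mul, mul_smul_comm, smul_mul_assoc, mul_one, one_mul]
  module

/-- If `m + t` and `m - t` lie in `Q` for a symmetric `t` and `m > 0`, then so does `m² - t²`. -/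
theorem sq_sub_sq_mem (hQ : IsCyclicQM n g Q) {t : MatP n g} (ht : t ∈ traceRing n g)
    (htt : tᵀ = t) {m : ℝ} (hm : 0 < m) (hadd : m • (1 : MatP n g) + t ∈ Q)
    (hsub : m • (1 : MatP n g) - t ∈ Q) : (m * m) • (1 : MatP n g) - t * t ∈ Q := by
  have hm1 : m • (1 : MatP n g) ∈ traceRing n g := Subalgebra.smul_mem _ (one_mem _) m
  refine hQ.of_smul_mem (r := 2 * m) (by positivity) ?_
  have h1 := hQ.add_mem (hQ.conj_mem (AddMemClass.add_mem hm1 ht) hsub)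
    (hQ.conj_mem (sub_mem hm1 ht) hadd)
  convert h1 using 1
  simp only [transpose_add, transpose_sub, transpose_smul, transpose_one, htt, mul_add, add_mul,
    mul_sub, sub_mul, mul_smul_comm, smul_mul_assoc, mul_one, one_mul, mul_assoc]
  module

theorem trace_mem_HQ_of_symm (hQ : IsCyclicQM n g Q) (hn : 0 < n) {s : MatP n g}
    (hs : s ∈ HQ n g Q) (hst : sᵀ = s) : trace s • (1 : MatP n g) ∈ HQ n g Q := by
  obtain ⟨hs, ρ, hρ0, hρ⟩ := hs
  have hρ0' : (0 : ℝ) < ρ := by exact_mod_cast hρ0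
  set c := √(ρ : ℝ)
  have hc0 : 0 < c := Real.sqrt_pos.2 hρ0'
  have hcc : c * c = ρ := Real.mul_self_sqrt hρ0'.le
  have hadd := hQ.smul_one_add_mem hs hst hc0 (by rwa [hcc, ← congrArg (s * ·) hst])
  have hsub := hQ.smul_one_add_mem (neg_mem hs) (by rw [transpose_neg, hst]) hc0
    (by rwa [hcc, neg_mul_neg, ← congrArg (s * ·) hst])
  have ht := trace_smul_one_mem_traceRing hs
  have htt : (trace s • (1 : MatP n g))ᵀ = trace s • (1 : MatP n g) := by
    rw [transpose_smul, transpose_one]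
  have trace_c : trace (c • (1 : MatP n g)) • (1 : MatP n g) = (n * c) • (1 : MatP n g) := by
    rw [trace_smul, trace_one, Fintype.card_fin, smul_assoc, Nat.cast_smul_eq_nsmul,
      ← Nat.cast_smul_eq_nsmul ℝ, smul_smul, mul_comm]
  have hadd' := hQ.2.2.2.2 _ hadd
  have hsub' := hQ.2.2.2.2 _ hsub
  rw [trace_add, add_smul, trace_c] at hadd' hsub'
  rw [trace_neg, neg_smul, ← sub_eq_add_neg] at hsub'
  have hm : (0 : ℝ) < n * c := mul_pos (by exact_mod_cast hn) hc0
  refine hQ.mem_HQ_of_real_bound ht (c := n * c * (n * c)) ?_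
  rw [htt]
  exact hQ.sq_sub_sq_mem ht htt hm hadd' hsub'

theorem trace_mem_HQ (hQ : IsCyclicQM n g Q) (hn : 0 < n) {a : MatP n g}
    (ha : a ∈ HQ n g Q) : trace a • (1 : MatP n g) ∈ HQ n g Q := by
  have h1 := hQ.trace_mem_HQ_of_symm hn (hQ.add_mem_HQ ha (hQ.transpose_mem_HQ ha))
    (by rw [transpose_add, transpose_transpose, add_comm])
  have h2 := hQ.mul_mem_HQ (hQ.smul_one_mem_HQ (1 / 2)) h1
  rw [trace_add, trace_transpose, smul_one_mul, add_smul, ← two_smul ℝ, smul_smul] at h2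
  simpa using h2

end IsCyclicQM

/-- For a cyclic quadratic module Q, the set H_Q of bounded elements is an
ℝ-subalgebra of TT_n closed under the transpose and the trace. -/
theorem stmt16 (n g : ℕ) (hn : 0 < n) (hg : 0 < g)
    (Q : Set (MatP n g)) (hQ : IsCyclicQM n g Q) :
    (∀ r : ℝ, r • (1 : MatP n g) ∈ HQ n g Q) ∧
    (∀ a ∈ HQ n g Q, ∀ b ∈ HQ n g Q, a + b ∈ HQ n g Q) ∧
    (∀ a ∈ HQ n g Q, ∀ b ∈ HQ n g Q, a * b ∈ HQ n g Q) ∧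
    (∀ a ∈ HQ n g Q, aᵀ ∈ HQ n g Q) ∧
    (∀ a ∈ HQ n g Q, (Matrix.trace a) • (1 : MatP n g) ∈ HQ n g Q) := by
  exact ⟨hQ.smul_one_mem_HQ, fun _ ha _ hb => hQ.add_mem_HQ ha hb,
    fun _ ha _ hb => hQ.mul_mem_HQ ha hb, fun _ ha => hQ.transpose_mem_HQ ha,
    fun _ ha => hQ.trace_mem_HQ hn ha⟩
end
end

section
/- Let F be a field of characteristic 0, n ≥ 1 and m an even positive integer. Then J(n, t) ⊆ J(m, s) if and only if 2m ≤ n; that is, every polynomial *-identity of M_n(F) with the transpose involution is a polynomial *-identity of M_m(F) with the symplectic involution precisely when 2m ≤ n. -/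
noncomputable section

open Matrix

/-- f ∈ F⟨x_i, x_i* : i ∈ ℕ⟩ (left summand: the x_i; right summand: the x_i*) is a
polynomial *-identity of (M_ι(F), τ): every evaluation x_i ↦ A_i, x_i* ↦ A_i^τ
vanishes. -/
def IsStarIdentity (F : Type) [Field F] (ι : Type) [Fintype ι] [DecidableEq ι]
    (τ : Matrix ι ι F → Matrix ι ι F) (f : FreeAlgebra F (ℕ ⊕ ℕ)) : Prop :=
  ∀ A : ℕ → Matrix ι ι F,
    (FreeAlgebra.lift F (Sum.elim A fun i => τ (A i))) f = 0

/-- The symplectic involution on M_{2k}(F): ((a,b),(c,d)) ↦ ((dᵀ,−bᵀ),(−cᵀ,aᵀ)). -/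
def sympInv (F : Type) [Field F] (k : ℕ)
    (X : Matrix (Fin k ⊕ Fin k) (Fin k ⊕ Fin k) F) :
    Matrix (Fin k ⊕ Fin k) (Fin k ⊕ Fin k) F :=
  Matrix.fromBlocks (X.toBlocks₂₂)ᵀ (-(X.toBlocks₁₂)ᵀ) (-(X.toBlocks₂₁)ᵀ)
    (X.toBlocks₁₁)ᵀ

open Polynomial in
/-- Over an infinite field, polynomials in an endomorphism which are linearly dependent at every
vector are linearly dependent as endomorphisms. -/
theorem not_linearIndependent_aeval_of_forall_vector {K V ι : Type*} [Field K] [Infinite K]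
    [AddCommGroup V] [Module K V] [FiniteDimensional K V] [Fintype ι]
    (T : Module.End K V) (q : ι → K[X])
    (h : ∀ v, ¬ LinearIndependent K fun i => aeval T (q i) v) :
    ¬ LinearIndependent K fun i => aeval T (q i) := by
  have hμ : minpoly K T ≠ 0 := minpoly.ne_zero (Algebra.IsIntegral.isIntegral T)
  have hfin : Finite {g : K[X] // g.Monic ∧ g ∣ minpoly K T} :=
    @Finite.of_fintype _ (fintypeSubtypeMonicDvd _ hμ)
  have hc : ∀ v, ∃ c : ι → K, (∃ i, c i ≠ 0) ∧ aeval T (∑ i, c i • q i) v = 0 := by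
    intro v
    obtain ⟨c, hc, hi⟩ := Fintype.not_linearIndependent_iff.1 (h v)
    exact ⟨c, hi, by simpa [LinearMap.sum_apply] using hc⟩
  let S := {g : {g : K[X] // g.Monic ∧ g ∣ minpoly K T} //
    ∃ c : ι → K, (∃ i, c i ≠ 0) ∧ g.1 ∣ ∑ i, c i • q i}
  have hcov : ⋃ g : S, (LinearMap.ker (aeval T g.1.1) : Set V) = Set.univ := by
    refine Set.eq_univ_of_forall fun v => Set.mem_iUnion.2 ?_
    obtain ⟨c, hi, hv⟩ := hc v
    set p := ∑ i, c i • q i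
    classical
    have hg0 : EuclideanDomain.gcd p (minpoly K T) ≠ 0 := fun h0 =>
      hμ (EuclideanDomain.gcd_eq_zero_iff.1 h0).2
    refine ⟨⟨⟨normalize (EuclideanDomain.gcd p (minpoly K T)), monic_normalize hg0,
      normalize_dvd_iff.2 (EuclideanDomain.gcd_dvd_right _ _)⟩, c, hi,
      normalize_dvd_iff.2 (EuclideanDomain.gcd_dvd_left _ _)⟩, ?_⟩
    obtain ⟨r, hr⟩ : EuclideanDomain.gcd p (minpoly K T) ∣
      normalize (EuclideanDomain.gcd p (minpoly K T)) := dvd_normalize_iff.2 dvd_rfl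
    change aeval T (normalize (EuclideanDomain.gcd p (minpoly K T))) v = 0
    rw [hr, EuclideanDomain.gcd_eq_gcd_ab, mul_comm, mul_add, map_add, mul_left_comm,
      mul_left_comm r, mul_comm p, mul_comm (minpoly K T)]
    simp [hv]
  obtain ⟨⟨g, c, hi, hdvd⟩, hg⟩ := Subspace.exists_eq_top_of_iUnion_eq_univ hcov
  refine Fintype.not_linearIndependent_iff.2 ⟨c, ?_, hi⟩
  obtain ⟨r, hr⟩ := hdvd
  have h0 := congrArg (aeval T) hr
  rw [map_mul, LinearMap.ker_eq_top.1 hg, zero_mul] at h0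
  simpa using h0

theorem dotProduct_mulVec_self_of_transpose_eq_neg {K ι : Type*} [Field K] [CharZero K] [Fintype ι]
    {B : Matrix ι ι K} (hB : Bᵀ = -B) (v : ι → K) : v ⬝ᵥ B *ᵥ v = 0 := by
  have h : v ⬝ᵥ B *ᵥ v = -(v ⬝ᵥ B *ᵥ v) := by
    conv_lhs => rw [dotProduct_comm, ← vecMul_transpose, hB, ← dotProduct_mulVec]
    simp [neg_mulVec]
  exact self_eq_neg.1 h

theorem transpose_mul_pow_eq_neg {K ι : Type*} [Field K] [Fintype ι] [DecidableEq ι]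
    {A B : Matrix ι ι K} (hA : Aᵀ = -A) (hB : Bᵀ = -B) (m : ℕ) :
    (B * (A * B) ^ m)ᵀ = -(B * (A * B) ^ m) := by
  have h : (A * B)ᵀ = B * A := by simp [hA, hB]
  rw [transpose_mul, transpose_pow, h, hB, mul_neg]
  congr 1
  induction m with
  | zero => simp
  | succ m ih => rw [pow_succ', Matrix.mul_assoc, ih, pow_succ']; simp only [Matrix.mul_assoc]

/-- If `A` and `B` are skew-symmetric of size less than `2m`, the vectors `(AB)v, …, (AB)ᵐv` are
linearly dependent: `v, …, (AB)ᵐ⁻¹v` spans a totally isotropic subspace for `B`. -/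
theorem not_linearIndependent_pow_mul_mulVec {K ι : Type*} [Field K] [CharZero K] [Fintype ι]
    [DecidableEq ι] {A B : Matrix ι ι K} (hA : Aᵀ = -A) (hB : Bᵀ = -B) {m : ℕ}
    (hm : Fintype.card ι < 2 * m) (v : ι → K) :
    ¬ LinearIndependent K fun i : Fin m => (A * B) ^ (i.1 + 1) *ᵥ v := by
  intro hli
  let u : Fin m → ι → K := fun i => (A * B) ^ i.1 *ᵥ v
  let w : Fin m → ι → K := fun i => B *ᵥ u i
  have hw : LinearIndependent K w := by
    refine LinearIndependent.of_comp (Matrix.mulVecLin A) ?_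
    convert hli using 2 with i
    simp [w, u, pow_succ', Matrix.mul_assoc]
  have hu : LinearIndependent K u := LinearIndependent.of_comp (Matrix.mulVecLin B) hw
  have hsym : ∀ i : ℕ, ((A * B) ^ i)ᵀ * B = B * (A * B) ^ i := by
    intro i
    have h := transpose_mul_pow_eq_neg hA hB i
    rw [transpose_mul, hB, mul_neg, neg_inj] at h
    exact h
  have horth : Matrix.of u * (Matrix.of w)ᵀ = 0 := by
    ext i j
    change u i ⬝ᵥ w j = 0
    have h : u i ⬝ᵥ w j = v ⬝ᵥ (B * (A * B) ^ (i.1 + j.1)) *ᵥ v := by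
      simp only [u, w]
      rw [← vecMul_transpose, ← dotProduct_mulVec, mulVec_mulVec, mulVec_mulVec, hsym,
        Matrix.mul_assoc, ← pow_add]
    rw [h, dotProduct_mulVec_self_of_transpose_eq_neg (transpose_mul_pow_eq_neg hA hB _)]
  have h := rank_add_rank_le_card_of_mul_eq_zero horth
  have hur : (Matrix.of u).rank = m := by
    simpa using LinearIndependent.rank_matrix (M := Matrix.of u) hu
  have hwr : (Matrix.of w).rank = m := by
    simpa using LinearIndependent.rank_matrix (M := Matrix.of w) hw
  rw [rank_transpose, hur, hwr] at h
  omega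

open Polynomial in
theorem not_linearIndependent_pow_mul {K ι : Type*} [Field K] [CharZero K] [Fintype ι]
    [DecidableEq ι] {A B : Matrix ι ι K} (hA : Aᵀ = -A) (hB : Bᵀ = -B) {m : ℕ}
    (hm : Fintype.card ι < 2 * m) :
    ¬ LinearIndependent K fun i : Fin m => (A * B) ^ (i.1 + 1) := by
  intro hli
  have haeval : ∀ i : Fin m, aeval (Matrix.toLinAlgEquiv' (A * B)) (X ^ (i.1 + 1) : K[X]) =
      Matrix.toLinAlgEquiv' ((A * B) ^ (i.1 + 1)) := fun i => by
    rw [map_pow, aeval_X, map_pow]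
  refine not_linearIndependent_aeval_of_forall_vector (Matrix.toLinAlgEquiv' (A * B))
    (fun i : Fin m => X ^ (i.1 + 1)) (fun v h => ?_) ?_
  · simp only [haeval, Matrix.toLinAlgEquiv'_apply] at h
    exact not_linearIndependent_pow_mul_mulVec hA hB hm v h
  · simp only [haeval]
    exact hli.map' Matrix.toLinAlgEquiv'.toLinearMap
      (LinearMap.ker_eq_bot.2 Matrix.toLinAlgEquiv'.injective)

/-- The Capelli-type expression `∑ sgn(σ) v_{σ 0} y_0 v_{σ 1} y_1 ⋯`, alternating in `v`. -/
def capelli (K : Type*) {R : Type*} [Field K] [Ring R] [Algebra K R] {m : ℕ} (y : Fin m → R) :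
    R [⋀^Fin m]→ₗ[K] R :=
  MultilinearMap.alternatization ((MultilinearMap.mkPiAlgebraFin K m R).compLinearMap
    fun i => LinearMap.mulRight K (y i))

theorem capelli_apply {K R : Type*} [Field K] [Ring R] [Algebra K R] {m : ℕ} (y v : Fin m → R) :
    capelli K y v = ∑ σ : Equiv.Perm (Fin m),
      Equiv.Perm.sign σ • (List.ofFn fun i => v (σ i) * y i).prod := by
  simp [capelli, MultilinearMap.alternatization_apply]

theorem map_capelli {K R S : Type*} [Field K] [Ring R] [Algebra K R] [Ring S] [Algebra K S]
    (φ : R →ₐ[K] S) {m : ℕ} (y v : Fin m → R) :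
    φ (capelli K y v) = capelli K (φ ∘ y) (φ ∘ v) := by
  simp [capelli_apply, map_list_prod, List.map_ofFn, Function.comp_def, Units.smul_def]

theorem diagonal_mul_single {R ι : Type*} [Semiring R] [Fintype ι] [DecidableEq ι] (d : ι → R)
    (i j : ι) (c : R) : diagonal d * single i j c = single i j (d i * c) := by
  ext a b
  by_cases h : i = a <;> simp [diagonal_mul, single_apply, h]

theorem prod_ofFn_diagonal_mul_single {K ι : Type*} [Field K] [Fintype ι] [DecidableEq ι]
    (j : ℕ → ι) {m : ℕ} (d : Fin (m + 1) → ι → K) :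
    (List.ofFn fun i : Fin (m + 1) =>
      diagonal (d i) * single (j i.1) (j (i.1 + 1)) (1 : K)).prod =
    single (j 0) (j (m + 1)) (∏ i, d i (j i.1)) := by
  induction m generalizing j with
  | zero => simp [diagonal_mul_single]
  | succ m ih =>
    have h := ih (fun i => j (i + 1)) (fun i => d i.succ)
    rw [List.ofFn_succ, List.prod_cons]
    simp only [Fin.val_succ]
    rw [h]
    simp [diagonal_mul_single, single_mul_single_same, Fin.prod_univ_succ]

theorem capelli_pow_diagonal_ne_zero {K ι : Type*} [Field K] [Fintype ι] [DecidableEq ι]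
    {m : ℕ} (j : ℕ → ι) {d : ι → K} (hd : ∀ i, d i ≠ 0)
    (hinj : Function.Injective fun i : Fin (m + 1) => d (j i.1)) :
    capelli K (fun i : Fin (m + 1) => single (j i.1) (j (i.1 + 1)) (1 : K))
      (fun i => diagonal d ^ (i.1 + 1)) ≠ 0 := by
  intro h
  have h1 := congrFun (congrFun h (j 0)) (j (m + 1))
  rw [capelli_apply] at h1
  simp only [diagonal_pow, prod_ofFn_diagonal_mul_single, Units.smul_def] at h1
  simp only [Matrix.sum_apply, Matrix.smul_apply, single_apply_same, Matrix.zero_apply] at h1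
  have h2 : (Matrix.of fun i l : Fin (m + 1) =>
      d (j l.1) * (vandermonde (fun i : Fin (m + 1) => d (j i.1)))ᵀ i l).det = 0 := by
    rw [det_apply, ← h1]
    simp [Units.smul_def, vandermonde_apply, pow_succ']
  rw [det_mul_row, det_transpose] at h2
  exact mul_ne_zero (Finset.prod_ne_zero_iff.2 fun i _ => hd _)
    (det_vandermonde_ne_zero_iff.2 hinj) h2

/-- The Capelli-type *-polynomial expressing that the first `m` powers of
`(x₀ - x₀*)(x₁ - x₁*)` are linearly dependent. -/
def skewProductCapelli (K : Type*) [Field K] (m : ℕ) : FreeAlgebra K (ℕ ⊕ ℕ) :=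
  capelli K (fun i : Fin m => FreeAlgebra.ι K (Sum.inl (i.1 + 2))) fun i : Fin m =>
    ((FreeAlgebra.ι K (Sum.inl 0) - FreeAlgebra.ι K (Sum.inr 0)) *
      (FreeAlgebra.ι K (Sum.inl 1) - FreeAlgebra.ι K (Sum.inr 1))) ^ (i.1 + 1)

theorem lift_skewProductCapelli {K R : Type*} [Field K] [Ring R] [Algebra K R] (m : ℕ)
    (A B : ℕ → R) :
    FreeAlgebra.lift K (Sum.elim A B) (skewProductCapelli K m) =
      capelli K (fun i : Fin m => A (i.1 + 2))
        fun i : Fin m => ((A 0 - B 0) * (A 1 - B 1)) ^ (i.1 + 1) := by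
  simp [skewProductCapelli, map_capelli, Function.comp_def]

theorem isStarIdentity_transpose_skewProductCapelli (F : Type) [Field F] [CharZero F] {n m : ℕ}
    (h : n < 2 * m) :
    IsStarIdentity F (Fin n) Matrix.transpose (skewProductCapelli F m) := by
  intro A
  rw [lift_skewProductCapelli]
  exact AlternatingMap.map_linearDependent _ _
    (not_linearIndependent_pow_mul (by simp) (by simp) (by simpa using h))

theorem not_isStarIdentity_sympInv_skewProductCapelli (F : Type) [Field F] [CharZero F] {k : ℕ}
    (hk : 1 ≤ k) :
    ¬ IsStarIdentity F (Fin k ⊕ Fin k) (sympInv F k) (skewProductCapelli F (2 * k)) := by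
  obtain ⟨m, hm⟩ : ∃ m, 2 * k = m + 1 := ⟨2 * k - 1, by omega⟩
  let e : Fin k ⊕ Fin k ≃ Fin (m + 1) := finSumFinEquiv.trans (finCongr (by omega))
  let j : ℕ → Fin k ⊕ Fin k := fun i => e.symm (Fin.ofNat (m + 1) i)
  let d : Fin k ⊕ Fin k → F := fun i => 4 * ((e i).1 + 1 : ℕ)
  let A : ℕ → Matrix (Fin k ⊕ Fin k) (Fin k ⊕ Fin k) F
    | 0 => fromBlocks 0 1 1 0
    | 1 => fromBlocks 0 (diagonal fun i => ((e (Sum.inr i)).1 + 1 : ℕ))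
        (diagonal fun i => ((e (Sum.inl i)).1 + 1 : ℕ)) 0
    | i + 2 => single (j i) (j (i + 1)) 1
  intro h
  have h0 := h A
  rw [hm, lift_skewProductCapelli] at h0
  have hx : (A 0 - sympInv F k (A 0)) * (A 1 - sympInv F k (A 1)) = diagonal d := by
    have hd : d = Sum.elim (d ∘ Sum.inl) (d ∘ Sum.inr) := by simp
    rw [hd, ← fromBlocks_diagonal]
    simp only [A, sympInv, sub_eq_add_neg, fromBlocks_neg, fromBlocks_add, fromBlocks_multiply,
      toBlocks_fromBlocks₁₁, toBlocks_fromBlocks₁₂, toBlocks_fromBlocks₂₁, toBlocks_fromBlocks₂₂]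
    congr 1 <;> ext a b <;> by_cases hab : a = b <;> simp [d, hab, add_mul] <;> ring
  rw [hx] at h0
  refine capelli_pow_diagonal_ne_zero (K := F) (m := m) j (d := d) (fun i => ?_) ?_ h0
  · simpa [d] using Nat.cast_add_one_ne_zero (R := F) _
  · intro a b hab
    have hab' : 4 * ((a.1 + 1 : ℕ) : F) = 4 * ((b.1 + 1 : ℕ) : F) := by
      simpa [d, j] using hab
    have := mul_left_cancel₀ (OfNat.ofNat_ne_zero 4) hab'
    rw [Nat.cast_inj] at this
    exact Fin.ext (by omega)

/-- The block diagonal embedding. -/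
def blockDiagAlgHom (R S ι κ : Type*) [CommRing R] [CommRing S] [Algebra R S] [Fintype ι]
    [Fintype κ] [DecidableEq ι] [DecidableEq κ] :
    Matrix ι ι S × Matrix κ κ S →ₐ[R] Matrix (ι ⊕ κ) (ι ⊕ κ) S :=
  AlgHom.ofLinearMap
    { toFun := fun X => fromBlocks X.1 0 0 X.2
      map_add' := fun X Y => by simp [fromBlocks_add]
      map_smul' := fun c X => by simp [fromBlocks_smul] }
    (by simp) (fun X Y => by simp [fromBlocks_multiply])

/-- Conjugation by an invertible matrix. -/
def conjAlgHom (R : Type*) {S ι : Type*} [CommRing R] [CommRing S] [Algebra R S] [Fintype ι]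
    [DecidableEq ι] (U V : Matrix ι ι S) (h : U * V = 1) :
    Matrix ι ι S →ₐ[R] Matrix ι ι S :=
  AlgHom.ofLinearMap
    { toFun := fun X => U * X * V
      map_add' := fun X Y => by simp [mul_add, add_mul]
      map_smul' := fun c X => by simp }
    (by simpa using h)
    (fun X Y => by
      have h' : V * U = 1 := mul_eq_one_comm.1 h
      calc U * (X * Y) * V = U * X * 1 * Y * V := by simp [Matrix.mul_assoc]
        _ = U * X * V * (U * Y * V) := by rw [← h']; simp only [Matrix.mul_assoc])

/-- A *-identity of matrices with transpose over an infinite field remains one after extension of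
scalars. -/
theorem IsStarIdentity.transpose_extend_scalars {F : Type} [Field F] [Infinite F] {ι : Type}
    [Fintype ι] [DecidableEq ι] {f : FreeAlgebra F (ℕ ⊕ ℕ)}
    (hf : IsStarIdentity F ι Matrix.transpose f) {K : Type} [CommRing K] [Algebra F K]
    (A : ℕ → Matrix ι ι K) :
    FreeAlgebra.lift F (Sum.elim A fun i => (A i)ᵀ) f = 0 := by
  let R := MvPolynomial (ℕ × ι × ι) F
  let G : ℕ → Matrix ι ι R := fun i => Matrix.of fun a b => MvPolynomial.X (i, a, b)
  have key : ∀ {L : Type} [CommRing L] [Algebra F L] (φ : R →ₐ[F] L) (B : ℕ → Matrix ι ι L),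
      (∀ i a b, φ (MvPolynomial.X (i, a, b)) = B i a b) →
      φ.mapMatrix (FreeAlgebra.lift F (Sum.elim G fun i => (G i)ᵀ) f) =
        FreeAlgebra.lift F (Sum.elim B fun i => (B i)ᵀ) f := by
    intro L _ _ φ B hB
    rw [← AlgHom.comp_apply]
    congr 1
    ext (i | i) a b <;> simp [G, hB]
  have hG : FreeAlgebra.lift F (Sum.elim G fun i => (G i)ᵀ) f = 0 := by
    refine Matrix.ext fun a b => MvPolynomial.funext fun x => ?_
    have h := key (MvPolynomial.aeval x) (fun i => Matrix.of fun a b => x (i, a, b))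
      fun i a b => MvPolynomial.aeval_X _ _
    rw [hf] at h
    rw [Matrix.zero_apply, map_zero, ← MvPolynomial.coe_aeval_eq_eval]
    exact congrFun (congrFun h a) b
  rw [← key (MvPolynomial.aeval fun p : ℕ × ι × ι => A p.1 p.2.1 p.2.2) A
    (fun i a b => MvPolynomial.aeval_X _ _), hG, map_zero]

theorem sympInv_sympInv {F : Type} [Field F] {k : ℕ}
    (X : Matrix (Fin k ⊕ Fin k) (Fin k ⊕ Fin k) F) : sympInv F k (sympInv F k X) = X := by
  simp [sympInv, fromBlocks_toBlocks]

theorem fromBlocks_zero_one_neg_one_zero_mul {K ι : Type*} [Field K] [Fintype ι] [DecidableEq ι] :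
    (fromBlocks 0 1 (-1) 0 * fromBlocks 0 (-1) 1 0 : Matrix (ι ⊕ ι) (ι ⊕ ι) K) = 1 := by
  simp [fromBlocks_multiply]

theorem conj_map_eq_transpose_map_sympInv {F K : Type} [Field F] [Field K] (φ : F →+* K) {k : ℕ}
    (X : Matrix (Fin k ⊕ Fin k) (Fin k ⊕ Fin k) F) :
    fromBlocks 0 1 (-1) 0 * X.map φ * fromBlocks 0 (-1) 1 0 = ((sympInv F k X).map φ)ᵀ := by
  conv_lhs => rw [← fromBlocks_toBlocks X]
  rw [sympInv, fromBlocks_map, fromBlocks_map, fromBlocks_multiply, fromBlocks_multiply,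
    fromBlocks_transpose]
  congr 1 <;> ext a b <;> simp

theorem conj_fromBlocks_diag {K ι : Type*} [Field K] [Fintype ι] [DecidableEq ι]
    {i h : K} (hi : i * i = -1) (X Y : Matrix ι ι K) :
    fromBlocks 1 1 (i • 1) (-(i • 1)) * fromBlocks X 0 0 Y *
      fromBlocks (h • 1) (-((h * i) • 1)) (h • 1) ((h * i) • 1) =
    fromBlocks (h • (X + Y)) (-((h * i) • (X - Y))) ((h * i) • (X - Y)) (h • (X + Y)) := by
  rw [fromBlocks_multiply, fromBlocks_multiply]
  congr 1 <;> ext a b <;> simp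
  · ring
  · ring
  · ring
  · linear_combination (-h * X a b - h * Y a b) * hi

theorem IsStarIdentity.sympInv_of_transpose {F : Type} [Field F] [CharZero F] {n k : ℕ}
    (hnk : 2 * (2 * k) ≤ n) {f : FreeAlgebra F (ℕ ⊕ ℕ)}
    (hf : IsStarIdentity F (Fin n) Matrix.transpose f) :
    IsStarIdentity F (Fin k ⊕ Fin k) (sympInv F k) f := by
  let K := AlgebraicClosure F
  obtain ⟨i, hi⟩ := IsAlgClosed.exists_pow_nat_eq (-1 : K) two_pos
  rw [sq] at hi
  let ι := Fin k ⊕ Fin k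
  let κ := Fin (n - 2 * (2 * k))
  let e : (ι ⊕ ι) ⊕ κ ≃ Fin n := Fintype.equivFinOfCardEq (by simp [ι, κ]; omega)
  let Q : Matrix (ι ⊕ ι) (ι ⊕ ι) K := fromBlocks 1 1 (i • 1) (-(i • 1))
  let Q' : Matrix (ι ⊕ ι) (ι ⊕ ι) K :=
    fromBlocks ((2⁻¹ : K) • 1) (-(((2⁻¹ : K) * i) • 1)) ((2⁻¹ : K) • 1) (((2⁻¹ : K) * i) • 1)
  have hQ : Q * Q' = 1 := by
    have h := conj_fromBlocks_diag (h := (2⁻¹ : K)) hi (1 : Matrix ι ι K) 1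
    rw [fromBlocks_one, Matrix.mul_one] at h
    have h2 : (2⁻¹ : K) • ((1 : Matrix ι ι K) + 1) = 1 := by
      rw [← two_smul K (1 : Matrix ι ι K), smul_smul, inv_mul_cancel₀ two_ne_zero, one_smul]
    rw [h2, sub_self, smul_zero, neg_zero, fromBlocks_one] at h
    exact h
  let J : Matrix ι ι K := fromBlocks 0 1 (-1) 0
  let J' : Matrix ι ι K := fromBlocks 0 (-1) 1 0
  have hJ : J * J' = 1 := fromBlocks_zero_one_neg_one_zero_mul
  let a : Matrix ι ι F × Matrix κ κ F →ₐ[F] Matrix ι ι K :=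
    (Algebra.ofId F K).mapMatrix.comp (AlgHom.fst F _ _)
  let b : Matrix ι ι F × Matrix κ κ F →ₐ[F] Matrix (ι ⊕ ι) (ι ⊕ ι) K :=
    (conjAlgHom F Q Q' hQ).comp
      ((blockDiagAlgHom F K ι ι).comp (a.prod ((conjAlgHom F J J' hJ).comp a)))
  let Ψ : Matrix ι ι F × Matrix κ κ F →ₐ[F] Matrix (Fin n) (Fin n) K :=
    (reindexAlgEquiv F K e).toAlgHom.comp ((blockDiagAlgHom F K (ι ⊕ ι) κ).comp
      (b.prod ((Algebra.ofId F K).mapMatrix.comp (AlgHom.snd F _ _))))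
  have hΨ : ∀ Z, Ψ Z = reindex e e (fromBlocks (b Z) 0 0 (Z.2.map (algebraMap F K))) :=
    fun Z => rfl
  have hb : ∀ Z, b Z = Q * fromBlocks (Z.1.map (algebraMap F K)) 0 0
      (J * Z.1.map (algebraMap F K) * J') * Q' := fun Z => rfl
  have hstar : ∀ X, Ψ (sympInv F k X, 0) = (Ψ (X, 0))ᵀ := by
    intro X
    have hbT : b (sympInv F k X, 0) = (b (X, 0))ᵀ := by
      rw [hb, hb, conj_map_eq_transpose_map_sympInv, conj_map_eq_transpose_map_sympInv,
        sympInv_sympInv, conj_fromBlocks_diag hi, conj_fromBlocks_diag hi, fromBlocks_transpose]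
      simp only [transpose_smul, transpose_add, transpose_sub, transpose_neg, transpose_transpose]
      congr 1
      · rw [add_comm]
      · rw [← smul_neg, neg_sub]
      · rw [← smul_neg, neg_sub]
      · rw [add_comm]
    rw [hΨ, hΨ, transpose_reindex, fromBlocks_transpose, hbT]
    simp
  have hinj : ∀ Z, Ψ Z = 0 → Z.1 = 0 := by
    intro Z hZ
    have hbZ : b Z = 0 := by
      have h := (reindex e e).injective ((hΨ Z).symm.trans (hZ.trans (by simp :
        (0 : Matrix (Fin n) (Fin n) K) = reindex e e 0)))
      exact congrArg toBlocks₁₁ h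
    have hQ' : Q' * Q = 1 := mul_eq_one_comm.1 hQ
    have hD : fromBlocks (Z.1.map (algebraMap F K)) 0 0 (J * Z.1.map (algebraMap F K) * J') = 0 := by
      have h := congrArg (fun M => Q' * M * Q) ((hb Z).symm.trans hbZ)
      simpa [Matrix.mul_assoc, hQ', ← Matrix.mul_assoc Q' Q] using h
    have hZ1 := congrArg toBlocks₁₁ hD
    ext p q
    have h := congrFun (congrFun hZ1 p) q
    exact (map_eq_zero (algebraMap F K)).1 h
  intro A
  let A₀ : ℕ → Matrix ι ι F × Matrix κ κ F := fun j => (A j, 0)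
  let B₀ : ℕ → Matrix ι ι F × Matrix κ κ F := fun j => (sympInv F k (A j), 0)
  have hfst : (FreeAlgebra.lift F (Sum.elim A₀ B₀) f).1 =
      FreeAlgebra.lift F (Sum.elim A fun j => sympInv F k (A j)) f := by
    change ((AlgHom.fst F _ _).comp (FreeAlgebra.lift F (Sum.elim A₀ B₀))) f = _
    congr 1
    ext (j | j) : 2 <;> simp [A₀, B₀]
  rw [← hfst]
  apply hinj
  rw [← hf.transpose_extend_scalars fun j => Ψ (A₀ j), ← AlgHom.comp_apply]
  congr 1
  ext (j | j) : 2 <;> simp [A₀, B₀, hstar]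

/-- Every polynomial *-identity of M_n(F) with the transpose involution is a
polynomial *-identity of M_{2k}(F) with the symplectic involution iff 2·(2k) ≤ n. -/
theorem stmt19 (F : Type) [Field F] [CharZero F] (n k : ℕ)
    (hn : 1 ≤ n) (hk : 1 ≤ k) :
    (∀ f : FreeAlgebra F (ℕ ⊕ ℕ),
        IsStarIdentity F (Fin n) Matrix.transpose f →
        IsStarIdentity F (Fin k ⊕ Fin k) (sympInv F k) f) ↔
      2 * (2 * k) ≤ n := by
  refine ⟨fun h => ?_, fun h f hf => hf.sympInv_of_transpose h⟩
  by_contra! hlt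
  exact not_isStarIdentity_sympInv_skewProductCapelli F hk
    (h _ (isStarIdentity_transpose_skewProductCapelli F hlt))
end
end
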